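/- Let R(q) = (q,q^4;q^5)_∞/(q^2,q^3;q^5)_∞ and E(q)=(q;q)_∞. Then R(q^4)/(R(q)^2 R(q^2)) - R(q)^2 R(q^2)/R(q^4) = 4q E(q^4) E(q^{20})^3/E(q^{10})^4. -/

import Mathlib

/-- Euler's product E(q) = ∏_{k≥0} (1 - q^{k+1}). -/
noncomputable def E (q : ℂ) : ℂ := ∏' k : ℕ, (1 - q ^ (k + 1))

/-- q-Pochhammer infinite product (a;q)_∞ = ∏_{k≥0} (1 - a q^k). -/
noncomputable def qp (a q : ℂ) : ℂ := ∏' k : ℕ, (1 - a * q ^ k)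

/-- Rogers–Ramanujan function G(q) = 1/((q,q^4;q^5)_∞). -/
noncomputable def G (q : ℂ) : ℂ := 1 / (qp q (q ^ 5) * qp (q ^ 4) (q ^ 5))

/-- Rogers–Ramanujan function H(q) = 1/((q^2,q^3;q^5)_∞). -/
noncomputable def H (q : ℂ) : ℂ := 1 / (qp (q ^ 2) (q ^ 5) * qp (q ^ 3) (q ^ 5))

/-- Rogers–Ramanujan continued fraction product R(q). -/
noncomputable def R (q : ℂ) : ℂ :=
  (qp q (q ^ 5) * qp (q ^ 4) (q ^ 5)) / (qp (q ^ 2) (q ^ 5) * qp (q ^ 3) (q ^ 5))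

open Filter Topology Finset

section qPochhammer

lemma multipliable_qp (a : ℂ) {q : ℂ} (hq : ‖q‖ < 1) :
    Multipliable fun k : ℕ ↦ 1 - a * q ^ k := by
  have h : Summable fun k : ℕ ↦ ‖-(a * q ^ k)‖ := by
    simpa [norm_mul, norm_pow] using
      (summable_geometric_of_lt_one (norm_nonneg q) hq).mul_left ‖a‖
  simpa [sub_eq_add_neg] using multipliable_one_add_of_summable h

lemma tendsto_qp (a : ℂ) {q : ℂ} (hq : ‖q‖ < 1) :
    Tendsto (fun n ↦ ∏ k ∈ range n, (1 - a * q ^ k)) atTop (𝓝 (qp a q)) :=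
  (multipliable_qp a hq).tendsto_prod_tprod_nat

lemma qp_ne_zero {a q : ℂ} (ha : ‖a‖ < 1) (hq : ‖q‖ < 1) : qp a q ≠ 0 := by
  have h : Summable fun k : ℕ ↦ ‖-(a * q ^ k)‖ := by
    simpa [norm_mul, norm_pow] using
      (summable_geometric_of_lt_one (norm_nonneg q) hq).mul_left ‖a‖
  have hne : ∀ k : ℕ, 1 + -(a * q ^ k) ≠ 0 := by
    intro k h0
    have h1 : a * q ^ k = 1 := by linear_combination -h0
    have h2 : ‖a * q ^ k‖ < 1 := by
      rw [norm_mul, norm_pow]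
      exact mul_lt_one_of_nonneg_of_lt_one_left (norm_nonneg _) ha
        (pow_le_one₀ (norm_nonneg _) hq.le)
    rw [h1] at h2
    simp at h2
  simpa [qp, sub_eq_add_neg] using tprod_one_add_ne_zero_of_summable hne h

lemma qp_self (q : ℂ) : qp q q = E q := by
  simp [qp, E, pow_succ']

lemma qp_split (a : ℂ) {q : ℂ} (hq : ‖q‖ < 1) {d : ℕ} (hd : d ≠ 0) :
    qp a q = ∏ i ∈ range d, qp (a * q ^ i) (q ^ d) := by
  have hqd : ‖q ^ d‖ < 1 := by
    rw [norm_pow]; exact pow_lt_one₀ (norm_nonneg _) hq hd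
  have h1 := (tendsto_qp a hq).comp
    (tendsto_id.const_mul_atTop' (Nat.pos_of_ne_zero hd))
  have h2 : Tendsto (fun n ↦ ∏ i ∈ range d, ∏ k ∈ range n, (1 - a * q ^ i * (q ^ d) ^ k)) atTop
      (𝓝 (∏ i ∈ range d, qp (a * q ^ i) (q ^ d))) :=
    tendsto_finsetProd _ fun i _ ↦ tendsto_qp _ hqd
  refine tendsto_nhds_unique h1 (h2.congr fun n ↦ ?_)
  simp only [Function.comp, id]
  induction n with
  | zero => simp
  | succ n ih =>
    rw [Nat.mul_succ, prod_range_add, ← ih, ← prod_mul_distrib]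
    refine prod_congr rfl fun i _ ↦ ?_
    rw [prod_range_succ, pow_add, pow_mul]
    ring

lemma qp_mul_qp_neg (a : ℂ) {q : ℂ} (hq : ‖q‖ < 1) :
    qp a q * qp (-a) q = qp (a ^ 2) (q ^ 2) := by
  have hq2 : ‖q ^ 2‖ < 1 := by
    rw [norm_pow]; exact pow_lt_one₀ (norm_nonneg _) hq two_ne_zero
  refine tendsto_nhds_unique ((tendsto_qp a hq).mul (tendsto_qp (-a) hq))
    ((tendsto_qp (a ^ 2) hq2).congr fun n ↦ ?_)
  rw [← prod_mul_distrib]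
  exact prod_congr rfl fun k _ ↦ by ring

lemma qp_eq_one_sub_mul (a : ℂ) {q : ℂ} (hq : ‖q‖ < 1) :
    qp a q = (1 - a) * qp (a * q) q := by
  refine tendsto_nhds_unique ((tendsto_add_atTop_iff_nat 1).2 (tendsto_qp a hq))
    (((tendsto_qp (a * q) hq).const_mul (1 - a)).congr fun n ↦ ?_)
  rw [prod_range_succ']
  simp only [pow_zero, mul_one]
  rw [mul_comm]
  congr 1
  exact prod_congr rfl fun k _ ↦ by ring

end qPochhammer

section qBinomial

/-- The Gaussian binomial coefficient. -/
def gaussBinom (p : ℂ) : ℕ → ℕ → ℂ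
  | _, 0 => 1
  | 0, _ + 1 => 0
  | N + 1, m + 1 => gaussBinom p N m + p ^ (m + 1) * gaussBinom p N (m + 1)

@[simp] lemma gaussBinom_zero_right (p : ℂ) (N : ℕ) : gaussBinom p N 0 = 1 := by
  cases N <;> simp [gaussBinom]

lemma gaussBinom_succ_succ (p : ℂ) (N m : ℕ) : gaussBinom p (N + 1) (m + 1) =
    gaussBinom p N m + p ^ (m + 1) * gaussBinom p N (m + 1) := by
  simp [gaussBinom]

lemma gaussBinom_eq_zero_of_lt (p : ℂ) {N m : ℕ} (h : N < m) : gaussBinom p N m = 0 := by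
  induction N generalizing m with
  | zero =>
    obtain ⟨m, rfl⟩ := Nat.exists_eq_succ_of_ne_zero h.ne'
    simp [gaussBinom]
  | succ N ih =>
    obtain ⟨m, rfl⟩ := Nat.exists_eq_succ_of_ne_zero (Nat.ne_zero_of_lt h)
    rw [Nat.succ_eq_add_one, gaussBinom_succ_succ, ih (by omega), ih (by omega)]
    simp

lemma gaussBinom_self (p : ℂ) (N : ℕ) : gaussBinom p N N = 1 := by
  induction N with
  | zero => simp
  | succ N ih => rw [gaussBinom_succ_succ, ih, gaussBinom_eq_zero_of_lt p N.lt_succ_self]; simp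

lemma gaussBinom_mul_prod_mul_prod (p : ℂ) (m k : ℕ) :
    gaussBinom p (m + k) m * (∏ i ∈ range m, (1 - p * p ^ i)) * ∏ i ∈ range k, (1 - p * p ^ i) =
      ∏ i ∈ range (m + k), (1 - p * p ^ i) := by
  induction m generalizing k with
  | zero => simp
  | succ m ihm =>
    induction k with
    | zero => simp [gaussBinom_self]
    | succ k ihk =>
      have h1 := ihm (k + 1)
      rw [show m + 1 + k = m + (k + 1) by ring] at ihk
      rw [show m + 1 + (k + 1) = m + (k + 1) + 1 by ring, gaussBinom_succ_succ,
        prod_range_succ _ (m + (k + 1))]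
      calc _ = (1 - p * p ^ m) * (gaussBinom p (m + (k + 1)) m * (∏ i ∈ range m, (1 - p * p ^ i)) *
              ∏ i ∈ range (k + 1), (1 - p * p ^ i)) + p ^ (m + 1) * (1 - p * p ^ k) *
              (gaussBinom p (m + (k + 1)) (m + 1) * (∏ i ∈ range (m + 1), (1 - p * p ^ i)) *
              ∏ i ∈ range k, (1 - p * p ^ i)) := by
            rw [prod_range_succ _ m, prod_range_succ _ k]; ring
        _ = _ := by rw [h1, ihk]; ring

theorem prod_one_add_mul_pow_odd (s z : ℂ) (N : ℕ) :
    ∏ k ∈ range N, (1 + z * s ^ (2 * k + 1)) =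
      ∑ m ∈ range (N + 1), gaussBinom (s ^ 2) N m * s ^ (m * m) * z ^ m := by
  induction N generalizing z with
  | zero => simp
  | succ N ih =>
    have h : ∏ k ∈ range N, (1 + z * s ^ (2 * (k + 1) + 1)) =
        ∑ m ∈ range (N + 1), gaussBinom (s ^ 2) N m * s ^ (m * m) * (z * s ^ 2) ^ m := by
      rw [← ih]
      exact prod_congr rfl fun k _ ↦ by ring
    rw [prod_range_succ', h, sum_range_succ' _ (N + 1)]
    have h' : ∑ m ∈ range (N + 1), gaussBinom (s ^ 2) N m * s ^ (m * m) * (z * s ^ 2) ^ m =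
        ∑ m ∈ range (N + 1),
          gaussBinom (s ^ 2) N (m + 1) * s ^ ((m + 1) * (m + 1)) * (z * s ^ 2) ^ (m + 1) + 1 := by
      have hlast := sum_range_succ
        (fun m ↦ gaussBinom (s ^ 2) N m * s ^ (m * m) * (z * s ^ 2) ^ m) (N + 1)
      rw [gaussBinom_eq_zero_of_lt _ N.lt_succ_self, sum_range_succ'] at hlast
      simpa using hlast.symm
    rw [mul_add]
    nth_rewrite 1 [h']
    simp only [gaussBinom_succ_succ, mul_zero, pow_zero, gaussBinom_zero_right, mul_one, zero_add,
      pow_one]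
    rw [add_right_comm, sum_mul, ← sum_add_distrib]
    congr 1
    exact sum_congr rfl fun m _ ↦ by ring

end qBinomial

section JacobiTripleProduct

/-- The two-sided theta series `∑ s ^ n² y ^ n`. -/
noncomputable def qTheta (s y : ℂ) : ℂ := ∑' n : ℤ, s ^ (n ^ 2) * y ^ n

lemma summable_nat_pow_sq_mul_pow {r t : ℝ} (hr0 : 0 < r) (hr : r < 1) (ht : 0 < t) :
    Summable fun n : ℕ ↦ r ^ (n ^ 2) * t ^ n := by
  refine summable_of_ratio_test_tendsto_lt_one (l := 0) zero_lt_one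
    (Eventually.of_forall fun n ↦ by positivity) ?_
  have h : Tendsto (fun n : ℕ ↦ r * t * (r ^ 2) ^ n) atTop (𝓝 (r * t * 0)) :=
    (tendsto_pow_atTop_nhds_zero_of_lt_one (by positivity)
      (pow_lt_one₀ hr0.le hr two_ne_zero)).const_mul _
  rw [mul_zero] at h
  refine h.congr fun n ↦ ?_
  rw [Real.norm_of_nonneg (by positivity), Real.norm_of_nonneg (by positivity),
    eq_div_iff (by positivity)]
  ring

lemma summable_norm_qTheta {s y : ℂ} (hs0 : s ≠ 0) (hs : ‖s‖ < 1) (hy : y ≠ 0) :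
    Summable fun n : ℤ ↦ ‖s ^ (n ^ 2) * y ^ n‖ := by
  have hs0' := norm_pos_iff.2 hs0
  refine Summable.of_nat_of_neg ?_ ?_
  · refine (summable_nat_pow_sq_mul_pow hs0' hs (norm_pos_iff.2 hy)).congr fun n ↦ ?_
    rw [norm_mul, norm_zpow, norm_zpow, zpow_natCast, ← Nat.cast_pow, zpow_natCast]
  · refine (summable_nat_pow_sq_mul_pow hs0' hs (norm_pos_iff.2 (inv_ne_zero hy))).congr
      fun n ↦ ?_
    rw [norm_mul, norm_zpow, norm_zpow, neg_sq, zpow_neg, zpow_natCast, ← Nat.cast_pow,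
      zpow_natCast, norm_inv, inv_pow]

lemma summable_qTheta {s y : ℂ} (hs0 : s ≠ 0) (hs : ‖s‖ < 1) (hy : y ≠ 0) :
    Summable fun n : ℤ ↦ s ^ (n ^ 2) * y ^ n :=
  (summable_norm_qTheta hs0 hs hy).of_norm

lemma prod_one_add_inv_mul_pow_odd {s y : ℂ} (hs0 : s ≠ 0) (hy : y ≠ 0) (n : ℕ) :
    ∏ k ∈ range n, (1 + y⁻¹ * s ^ (2 * k + 1)) =
      s ^ (n ^ 2) / y ^ n * ∏ k ∈ range n, (1 + y / s ^ (2 * n) * s ^ (2 * k + 1)) := by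
  induction n with
  | zero => simp
  | succ n ih =>
    have h : ∏ k ∈ range n, (1 + y / s ^ (2 * (n + 1)) * s ^ (2 * (k + 1) + 1)) =
        ∏ k ∈ range n, (1 + y / s ^ (2 * n) * s ^ (2 * k + 1)) :=
      prod_congr rfl fun k _ ↦ by field_simp; ring
    rw [prod_range_succ, prod_range_succ', ih, h]
    field_simp
    ring

lemma prod_mul_prod_eq_sum_gaussBinom {s y : ℂ} (hs0 : s ≠ 0) (hy : y ≠ 0) (n : ℕ) :
    (∏ k ∈ range n, (1 + y * s ^ (2 * k + 1))) * ∏ k ∈ range n, (1 + y⁻¹ * s ^ (2 * k + 1)) =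
      ∑ m ∈ range (2 * n + 1), gaussBinom (s ^ 2) (2 * n) m *
        (s ^ (((m : ℤ) - n) ^ 2) * y ^ ((m : ℤ) - n)) := by
  have h := prod_one_add_mul_pow_odd s (y / s ^ (2 * n)) (2 * n)
  have h2 : ∏ k ∈ range n, (1 + y / s ^ (2 * n) * s ^ (2 * (n + k) + 1)) =
      ∏ k ∈ range n, (1 + y * s ^ (2 * k + 1)) :=
    prod_congr rfl fun k _ ↦ by field_simp; ring
  rw [two_mul n, prod_range_add, ← two_mul n, h2] at h
  rw [prod_one_add_inv_mul_pow_odd hs0 hy, mul_left_comm, mul_comm (∏ k ∈ range n, _), h, mul_sum]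
  refine sum_congr rfl fun m _ ↦ ?_
  have e : ((m : ℤ) - n) ^ 2 = ((m * m : ℕ) : ℤ) + ((n ^ 2 : ℕ) : ℤ) - ((2 * n * m : ℕ) : ℤ) := by
    push_cast; ring
  rw [e, zpow_sub₀ hs0, zpow_add₀ hs0, zpow_sub₀ hy]
  simp only [zpow_natCast]
  rw [div_pow, ← pow_mul]
  field_simp

lemma norm_sq_lt_one {s : ℂ} (hs : ‖s‖ < 1) : ‖s ^ 2‖ < 1 := by
  rw [norm_pow]; exact pow_lt_one₀ (norm_nonneg _) hs two_ne_zero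

lemma prod_one_sub_ne_zero {p : ℂ} (hp : ‖p‖ < 1) (n : ℕ) :
    ∏ i ∈ range n, (1 - p * p ^ i) ≠ 0 := by
  refine prod_ne_zero_iff.2 fun i _ h0 ↦ ?_
  have h1 : p ^ (i + 1) = 1 := by linear_combination -h0
  have h2 : ‖p ^ (i + 1)‖ < 1 := by
    rw [norm_pow]; exact pow_lt_one₀ (norm_nonneg _) hp i.succ_ne_zero
  rw [h1] at h2
  simp at h2

lemma gaussBinom_eq_div {p : ℂ} (hp : ‖p‖ < 1) (m k : ℕ) :
    gaussBinom p (m + k) m = (∏ i ∈ range (m + k), (1 - p * p ^ i)) *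
      (∏ i ∈ range m, (1 - p * p ^ i))⁻¹ * (∏ i ∈ range k, (1 - p * p ^ i))⁻¹ := by
  rw [← gaussBinom_mul_prod_mul_prod]
  have h1 := prod_one_sub_ne_zero hp m
  have h2 := prod_one_sub_ne_zero hp k
  field_simp

lemma E_ne_zero {p : ℂ} (hp : ‖p‖ < 1) : E p ≠ 0 := qp_self p ▸ qp_ne_zero hp hp

lemma tendsto_prod_one_sub {p : ℂ} (hp : ‖p‖ < 1) :
    Tendsto (fun n ↦ ∏ i ∈ range n, (1 - p * p ^ i)) atTop (𝓝 (E p)) :=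
  qp_self p ▸ tendsto_qp p hp

lemma exists_norm_gaussBinom_le {p : ℂ} (hp : ‖p‖ < 1) :
    ∃ C, ∀ N m, ‖gaussBinom p N m‖ ≤ C := by
  have h := tendsto_prod_one_sub hp
  obtain ⟨M, hM⟩ := (Metric.isBounded_range_of_tendsto _ h).exists_norm_le
  obtain ⟨M', hM'⟩ :=
    (Metric.isBounded_range_of_tendsto _ (h.inv₀ (E_ne_zero hp))).exists_norm_le
  simp only [Set.forall_mem_range] at hM hM'
  have hM0 : 0 ≤ M := (norm_nonneg _).trans (hM 0)
  have hM0' : 0 ≤ M' := (norm_nonneg _).trans (hM' 0)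
  refine ⟨M * M' * M', fun N m ↦ ?_⟩
  rcases lt_or_ge N m with hlt | hle
  · rw [gaussBinom_eq_zero_of_lt p hlt, norm_zero]; positivity
  · obtain ⟨k, rfl⟩ := Nat.exists_eq_add_of_le hle
    rw [gaussBinom_eq_div hp, norm_mul, norm_mul]
    gcongr
    exacts [hM _, hM' _, hM' _]

lemma tendsto_gaussBinom {p : ℂ} (hp : ‖p‖ < 1) (j : ℤ) :
    Tendsto (fun n : ℕ ↦ gaussBinom p (2 * n) (j + n).toNat) atTop (𝓝 (E p)⁻¹) := by
  have h := tendsto_prod_one_sub hp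
  have hinv := h.inv₀ (E_ne_zero hp)
  have h1 : Tendsto (fun n : ℕ ↦ 2 * n) atTop atTop :=
    tendsto_atTop_atTop.2 fun b ↦ ⟨b, fun n hn ↦ by omega⟩
  have h2 : Tendsto (fun n : ℕ ↦ (j + n).toNat) atTop atTop :=
    tendsto_atTop_atTop.2 fun b ↦ ⟨b + j.natAbs, fun n hn ↦ by omega⟩
  have h3 : Tendsto (fun n : ℕ ↦ (n - j).toNat) atTop atTop :=
    tendsto_atTop_atTop.2 fun b ↦ ⟨b + j.natAbs, fun n hn ↦ by omega⟩
  have h4 := ((h.comp h1).mul (hinv.comp h2)).mul (hinv.comp h3)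
  rw [mul_inv_cancel₀ (E_ne_zero hp), one_mul] at h4
  refine h4.congr' ?_
  filter_upwards [eventually_ge_atTop j.natAbs] with n hn
  have e : 2 * n = (j + n).toNat + (n - j).toNat := by omega
  simp only [Function.comp]
  rw [e, gaussBinom_eq_div hp]

/-- The Jacobi triple product identity. -/
theorem qTheta_eq_mul_qp {s y : ℂ} (hs0 : s ≠ 0) (hs : ‖s‖ < 1) (hy : y ≠ 0) :
    qTheta s y = E (s ^ 2) * (qp (-(y * s)) (s ^ 2) * qp (-(y⁻¹ * s)) (s ^ 2)) := by
  have hp := norm_sq_lt_one hs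
  let f : ℕ → ℤ → ℂ := fun n j ↦
    if 0 ≤ j + n then gaussBinom (s ^ 2) (2 * n) (j + n).toNat * (s ^ (j ^ 2) * y ^ j) else 0
  obtain ⟨C, hC⟩ := exists_norm_gaussBinom_le hp
  have hC0 : 0 ≤ C := (norm_nonneg _).trans (hC 0 0)
  have hlim : Tendsto (fun n ↦ ∑' j, f n j) atTop
      (𝓝 (∑' j : ℤ, (E (s ^ 2))⁻¹ * (s ^ (j ^ 2) * y ^ j))) := by
    refine tendsto_tsum_of_dominated_convergence ((summable_norm_qTheta hs0 hs hy).mul_left C)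
      (fun j ↦ ?_) (Eventually.of_forall fun n j ↦ ?_)
    · refine ((tendsto_gaussBinom hp j).mul_const _).congr' ?_
      filter_upwards [eventually_ge_atTop j.natAbs] with n hn
      simp only [f]
      rw [if_pos (by omega)]
    · simp only [f]
      split_ifs
      · rw [norm_mul]
        gcongr
        exact hC _ _
      · rw [norm_zero]; positivity
  have hsum : ∀ n, ∑' j, f n j = (∏ k ∈ range n, (1 - -(y * s) * (s ^ 2) ^ k)) *
      ∏ k ∈ range n, (1 - -(y⁻¹ * s) * (s ^ 2) ^ k) := by
    intro n
    have e1 : ∀ z : ℂ, ∏ k ∈ range n, (1 - -(z * s) * (s ^ 2) ^ k) =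
        ∏ k ∈ range n, (1 + z * s ^ (2 * k + 1)) :=
      fun z ↦ prod_congr rfl fun k _ ↦ by ring
    rw [e1, e1, prod_mul_prod_eq_sum_gaussBinom hs0 hy, ← (Equiv.subRight (n : ℤ)).tsum_eq (f n),
      ← (Nat.cast_injective (R := ℤ)).tsum_eq, tsum_eq_sum (s := range (2 * n + 1))]
    · refine sum_congr rfl fun m _ ↦ ?_
      simp [f]
    · intro m hm
      have hm' : 2 * n < m := by simpa [Nat.lt_succ_iff] using hm
      simp [f, gaussBinom_eq_zero_of_lt _ hm']
    · intro j hj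
      by_contra hneg
      apply hj
      have : ¬ 0 ≤ j := fun h ↦ hneg ⟨j.toNat, by simp [h]⟩
      simp [f, this]
  rw [tsum_mul_left] at hlim
  have huniq := tendsto_nhds_unique hlim
    (((tendsto_qp _ hp).mul (tendsto_qp _ hp)).congr fun n ↦ (hsum n).symm)
  rw [← huniq, mul_inv_cancel_left₀ (E_ne_zero hp), qTheta]

end JacobiTripleProduct

section ThetaAddition

/-- The index-two sublattice decomposition of `ℤ × ℤ`. -/
def sumDiff : (ℤ × ℤ) ⊕ (ℤ × ℤ) → ℤ × ℤ
  | Sum.inl (u, v) => (u + v, u - v)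
  | Sum.inr (u, v) => (u + v + 1, u - v)

lemma sumDiff_bijective : Function.Bijective sumDiff := by
  constructor
  · rintro (⟨u, v⟩ | ⟨u, v⟩) (⟨u', v'⟩ | ⟨u', v'⟩) h <;> simp [sumDiff] at h ⊢ <;> omega
  · rintro ⟨m, n⟩
    rcases Int.even_or_odd (m + n) with ⟨k, hk⟩ | ⟨k, hk⟩
    · exact ⟨Sum.inl (k, m - k), by simp [sumDiff]; omega⟩
    · exact ⟨Sum.inr (k, m - 1 - k), by simp [sumDiff]; omega⟩

lemma sq_zpow_mul_sq_zpow {s : ℂ} (hs0 : s ≠ 0) {m n u v : ℤ} (h : m + n = 2 * u + 2 * v) :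
    s ^ m * s ^ n = (s ^ 2) ^ u * (s ^ 2) ^ v := by
  rw [← zpow_add₀ hs0, h, zpow_add₀ hs0, zpow_mul, zpow_mul]
  rfl

lemma zpow_add_mul_zpow_sub {x y : ℂ} (hx : x ≠ 0) (hy : y ≠ 0) (u v : ℤ) :
    x ^ (u + v) * y ^ (u - v) = (x * y) ^ u * (x / y) ^ v := by
  rw [zpow_add₀ hx, zpow_sub₀ hy, mul_zpow, div_zpow]
  ring

lemma theta_term_even {s x y : ℂ} (hs0 : s ≠ 0) (hx : x ≠ 0) (hy : y ≠ 0) (u v : ℤ) :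
    s ^ ((u + v) ^ 2) * x ^ (u + v) * (s ^ ((u - v) ^ 2) * y ^ (u - v)) =
      (s ^ 2) ^ (u ^ 2) * (x * y) ^ u * ((s ^ 2) ^ (v ^ 2) * (x / y) ^ v) := by
  rw [mul_mul_mul_comm, zpow_add_mul_zpow_sub hx hy,
    sq_zpow_mul_sq_zpow hs0 (u := u ^ 2) (v := v ^ 2) (by ring)]
  ring

lemma theta_term_odd {s x y : ℂ} (hs0 : s ≠ 0) (hx : x ≠ 0) (hy : y ≠ 0) (u v : ℤ) :
    s ^ ((u + v + 1) ^ 2) * x ^ (u + v + 1) * (s ^ ((u - v) ^ 2) * y ^ (u - v)) =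
      s * x * ((s ^ 2) ^ (u ^ 2) * (s ^ 2 * (x * y)) ^ u *
        ((s ^ 2) ^ (v ^ 2) * (s ^ 2 * (x / y)) ^ v)) := by
  have h := sq_zpow_mul_sq_zpow hs0 (m := (u + v + 1) ^ 2 - 1) (n := (u - v) ^ 2)
    (u := u ^ 2 + u) (v := v ^ 2 + v) (by ring)
  have hp0 : s ^ 2 ≠ 0 := pow_ne_zero 2 hs0
  rw [zpow_add₀ hp0, zpow_add₀ hp0] at h
  rw [show (u + v + 1) ^ 2 = (u + v + 1) ^ 2 - 1 + 1 by ring, zpow_add_one₀ hs0,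
    zpow_add_one₀ hx, mul_zpow _ (x * y), mul_zpow _ (x / y)]
  linear_combination (s * x * x ^ (u + v) * y ^ (u - v)) * h +
    (s * x * ((s ^ 2) ^ u ^ 2 * (s ^ 2) ^ u * ((s ^ 2) ^ v ^ 2 * (s ^ 2) ^ v))) *
      zpow_add_mul_zpow_sub hx hy u v

lemma hasSum_qTheta_mul_qTheta {t a b : ℂ} (ht0 : t ≠ 0) (ht : ‖t‖ < 1) (ha : a ≠ 0)
    (hb : b ≠ 0) :
    HasSum (fun z : ℤ × ℤ ↦ t ^ (z.1 ^ 2) * a ^ z.1 * (t ^ (z.2 ^ 2) * b ^ z.2))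
      (qTheta t a * qTheta t b) := by
  have h := summable_mul_of_summable_norm (summable_norm_qTheta ht0 ht ha)
    (summable_norm_qTheta ht0 ht hb)
  exact HasSum.mul (f := fun n : ℤ ↦ t ^ (n ^ 2) * a ^ n) (g := fun n : ℤ ↦ t ^ (n ^ 2) * b ^ n)
    (summable_qTheta ht0 ht ha).hasSum (summable_qTheta ht0 ht hb).hasSum h

lemma qTheta_mul_qTheta {s x y : ℂ} (hs0 : s ≠ 0) (hs : ‖s‖ < 1) (hx : x ≠ 0) (hy : y ≠ 0) :
    qTheta s x * qTheta s y = qTheta (s ^ 2) (x * y) * qTheta (s ^ 2) (x / y) +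
      s * x * (qTheta (s ^ 2) (s ^ 2 * (x * y)) * qTheta (s ^ 2) (s ^ 2 * (x / y))) := by
  have hp0 : s ^ 2 ≠ 0 := pow_ne_zero 2 hs0
  have hp := norm_sq_lt_one hs
  have hxy := mul_ne_zero hx hy
  have hxy' := div_ne_zero hx hy
  have h0 := (Equiv.ofBijective _ sumDiff_bijective).hasSum_iff.2
    (hasSum_qTheta_mul_qTheta hs0 hs hx hy)
  have he := hasSum_qTheta_mul_qTheta hp0 hp hxy hxy'
  have ho := (hasSum_qTheta_mul_qTheta hp0 hp (mul_ne_zero hp0 hxy)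
    (mul_ne_zero hp0 hxy')).mul_left (s * x)
  simp only [← theta_term_even hs0 hx hy] at he
  simp only [← theta_term_odd hs0 hx hy] at ho
  exact h0.unique (HasSum.sum he ho)

lemma qTheta_sq_mul {t z : ℂ} (ht0 : t ≠ 0) (hz : z ≠ 0) :
    qTheta t (t ^ 2 * z) = t⁻¹ * z⁻¹ * qTheta t z := by
  rw [qTheta, qTheta, ← (Equiv.addRight (1 : ℤ)).tsum_eq (fun n : ℤ ↦ t ^ (n ^ 2) * z ^ n),
    ← tsum_mul_left]
  refine tsum_congr fun n ↦ ?_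
  rw [Equiv.coe_addRight, show (n + 1) ^ 2 = n ^ 2 + 2 * n + 1 by ring, zpow_add₀ ht0,
    zpow_add₀ ht0, zpow_add₀ hz, mul_zpow, zpow_mul, zpow_one, zpow_one]
  field_simp

/-- A degenerate case of the Weierstrass three-term relation for theta functions. -/
theorem qTheta_weierstrass {s a b : ℂ} (hs0 : s ≠ 0) (hs : ‖s‖ < 1) (ha : a ≠ 0) (hb : b ≠ 0) :
    qTheta s a ^ 2 * qTheta s (-b) ^ 2 - qTheta s (-a) ^ 2 * qTheta s b ^ 2 =
      -(s * b) * qTheta s s⁻¹ ^ 2 * (qTheta s (-(a * b * s)) * qTheta s (-(a / (b * s)))) := by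
  have hsq : ∀ x : ℂ, x ≠ 0 → qTheta s x ^ 2 = qTheta (s ^ 2) (x ^ 2) * qTheta (s ^ 2) 1 +
      s * x * (qTheta (s ^ 2) (s ^ 2 * x ^ 2) * qTheta (s ^ 2) (s ^ 2)) := fun x hx ↦ by
    rw [sq (qTheta s x), qTheta_mul_qTheta hs0 hs hx hx, div_self hx, mul_one, sq x]
  have hp0 : s ^ 2 ≠ 0 := pow_ne_zero 2 hs0
  have hinv : qTheta (s ^ 2) (s⁻¹ ^ 2) = qTheta (s ^ 2) (s ^ 2) := by
    have h := qTheta_sq_mul hp0 (z := s⁻¹ ^ 2) (by positivity)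
    rw [show (s ^ 2) ^ 2 * s⁻¹ ^ 2 = s ^ 2 by field_simp,
      show (s ^ 2)⁻¹ * (s⁻¹ ^ 2)⁻¹ = 1 by field_simp, one_mul] at h
    exact h.symm
  have hb2 : qTheta (s ^ 2) (s ^ 2 * (s ^ 2 * b ^ 2)) =
      (s ^ 2)⁻¹ * (b ^ 2)⁻¹ * qTheta (s ^ 2) (b ^ 2) := by
    rw [← qTheta_sq_mul hp0 (pow_ne_zero 2 hb)]
    congr 1; ring
  rw [hsq a ha, hsq b hb, hsq (-a) (neg_ne_zero.2 ha), hsq (-b) (neg_ne_zero.2 hb),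
    hsq s⁻¹ (inv_ne_zero hs0), hinv, qTheta_mul_qTheta hs0 hs
      (neg_ne_zero.2 (mul_ne_zero (mul_ne_zero ha hb) hs0))
      (neg_ne_zero.2 (div_ne_zero ha (mul_ne_zero hb hs0))),
    show -(a * b * s) * -(a / (b * s)) = a ^ 2 by field_simp,
    show -(a * b * s) / -(a / (b * s)) = s ^ 2 * b ^ 2 by field_simp, hb2, neg_sq, neg_sq,
    show s ^ 2 * s⁻¹ ^ 2 = 1 by field_simp]
  field_simp
  ring

/-- The modified theta function `(x; p)_∞ (p / x; p)_∞`. -/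
noncomputable def mTheta (x p : ℂ) : ℂ := qp x p * qp (p / x) p

lemma qTheta_eq_mTheta {s x y : ℂ} (hs0 : s ≠ 0) (hs : ‖s‖ < 1) (hx : x ≠ 0) (hy : y = -(x / s)) :
    qTheta s y = E (s ^ 2) * mTheta x (s ^ 2) := by
  subst hy
  rw [qTheta_eq_mul_qp hs0 hs (neg_ne_zero.2 (div_ne_zero hx hs0)), mTheta]
  congr 3 <;> field_simp

theorem mTheta_weierstrass {s a b : ℂ} (hs0 : s ≠ 0) (hs : ‖s‖ < 1) (ha : a ≠ 0) (hb : b ≠ 0) :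
    mTheta (-a) (s ^ 2) ^ 2 * mTheta b (s ^ 2) ^ 2 - mTheta a (s ^ 2) ^ 2 * mTheta (-b) (s ^ 2) ^ 2 =
      -b * mTheta (-1) (s ^ 2) ^ 2 * (mTheta (a * b) (s ^ 2) * mTheta (a / b) (s ^ 2)) := by
  have h := qTheta_weierstrass hs0 hs (div_ne_zero ha hs0) (div_ne_zero hb hs0)
  have key := fun {x y : ℂ} ↦ qTheta_eq_mTheta (x := x) (y := y) hs0 hs
  rw [key (neg_ne_zero.2 ha) (by ring), key ha rfl, key hb rfl, key (neg_ne_zero.2 hb) (by ring),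
    key (x := -1) (by norm_num) (by ring), key (mul_ne_zero ha hb) (by field_simp),
    key (div_ne_zero ha hb) (by field_simp), mul_div_cancel₀ _ hs0] at h
  have hE := E_ne_zero (norm_sq_lt_one hs)
  refine mul_left_cancel₀ (pow_ne_zero 4 hE) ?_
  linear_combination h

end ThetaAddition

lemma norm_pow_lt_one {q : ℂ} (hq : ‖q‖ < 1) {n : ℕ} (hn : n ≠ 0) : ‖q ^ n‖ < 1 := by
  rw [norm_pow]; exact pow_lt_one₀ (norm_nonneg _) hq hn

lemma qp_pow_pow_split {q : ℂ} (hq : ‖q‖ < 1) (a : ℕ) {m : ℕ} (hm : m ≠ 0) :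
    qp (q ^ a) (q ^ m) = qp (q ^ a) (q ^ (2 * m)) * qp (q ^ (a + m)) (q ^ (2 * m)) := by
  rw [qp_split (q ^ a) (norm_pow_lt_one hq hm) two_ne_zero, prod_range_succ, prod_range_one,
    pow_zero, mul_one, pow_one, ← pow_mul, ← pow_add, mul_comm m 2]

lemma qp_pow_mul_qp_neg_pow {q : ℂ} (hq : ‖q‖ < 1) (a : ℕ) {m : ℕ} (hm : m ≠ 0) :
    qp (q ^ a) (q ^ m) * qp (-q ^ a) (q ^ m) = qp (q ^ (2 * a)) (q ^ (2 * m)) := by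
  rw [qp_mul_qp_neg _ (norm_pow_lt_one hq hm), ← pow_mul, ← pow_mul, mul_comm a, mul_comm m]

lemma qp_pow_ne_zero {q : ℂ} (hq : ‖q‖ < 1) {a m : ℕ} (ha : a ≠ 0) (hm : m ≠ 0) :
    qp (q ^ a) (q ^ m) ≠ 0 :=
  qp_ne_zero (norm_pow_lt_one hq ha) (norm_pow_lt_one hq hm)

lemma E_pow_four {q : ℂ} (hq : ‖q‖ < 1) :
    E (q ^ 4) = qp (q ^ 4) (q ^ 20) * qp (q ^ 8) (q ^ 20) * qp (q ^ 12) (q ^ 20) *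
      qp (q ^ 16) (q ^ 20) * E (q ^ 20) := by
  rw [← qp_self, ← qp_self, qp_split (q ^ 4) (norm_pow_lt_one hq four_ne_zero)
    (d := 5) (by norm_num)]
  simp only [prod_range_succ, prod_range_zero, ← pow_mul, ← pow_add]
  norm_num

lemma mTheta_neg_one {p : ℂ} (hp : ‖p‖ < 1) :
    mTheta (-1) p = 2 * (E (p ^ 2) / E p) ^ 2 := by
  have hE := E_ne_zero hp
  have h : qp (-p) p = E (p ^ 2) / E p := by
    rw [eq_div_iff hE, ← qp_self, ← qp_self, mul_comm, qp_mul_qp_neg p hp]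
  rw [mTheta, qp_eq_one_sub_mul (-1) hp, show p / -1 = -p by ring, show (-1) * p = -p by ring, h]
  ring

lemma mTheta_pow {q : ℂ} (hq0 : q ≠ 0) {a b m : ℕ} (h : a + b = m) :
    mTheta (q ^ a) (q ^ m) = qp (q ^ a) (q ^ m) * qp (q ^ b) (q ^ m) := by
  rw [mTheta, ← h, pow_add, mul_div_cancel_left₀ _ (pow_ne_zero a hq0)]

lemma mTheta_neg_pow {q : ℂ} (hq0 : q ≠ 0) {a b m : ℕ} (h : a + b = m) :
    mTheta (-q ^ a) (q ^ m) = qp (-q ^ a) (q ^ m) * qp (-q ^ b) (q ^ m) := by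
  rw [mTheta, ← h, pow_add, div_neg, mul_div_cancel_left₀ _ (pow_ne_zero a hq0)]

lemma qp_level_ten_identity {q : ℂ} (hq0 : q ≠ 0) (hq : ‖q‖ < 1) :
    (qp (-q ^ 3) (q ^ 10) * qp (-q ^ 7) (q ^ 10)) ^ 2 *
        (qp (q ^ 1) (q ^ 10) * qp (q ^ 9) (q ^ 10)) ^ 2 -
      (qp (q ^ 3) (q ^ 10) * qp (q ^ 7) (q ^ 10)) ^ 2 *
        (qp (-q ^ 1) (q ^ 10) * qp (-q ^ 9) (q ^ 10)) ^ 2 =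
      -(4 * q * (E (q ^ 20) / E (q ^ 10)) ^ 4 * (qp (q ^ 4) (q ^ 10) * qp (q ^ 6) (q ^ 10) *
        (qp (q ^ 2) (q ^ 10) * qp (q ^ 8) (q ^ 10)))) := by
  have h := mTheta_weierstrass (a := q ^ 3) (b := q ^ 1) (pow_ne_zero 5 hq0)
    (norm_pow_lt_one hq (n := 5) (by norm_num)) (pow_ne_zero 3 hq0) (pow_ne_zero 1 hq0)
  rw [show q ^ 3 * q ^ 1 = q ^ 4 by ring, show q ^ 3 / q ^ 1 = q ^ 2 by field_simp,
    show (q ^ 5) ^ 2 = q ^ 10 by ring, mTheta_neg_one (norm_pow_lt_one hq (by norm_num)),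
    show (q ^ 10) ^ 2 = q ^ 20 by ring, mTheta_pow hq0 (show 3 + 7 = 10 by rfl),
    mTheta_pow hq0 (show 1 + 9 = 10 by rfl), mTheta_pow hq0 (show 4 + 6 = 10 by rfl),
    mTheta_pow hq0 (show 2 + 8 = 10 by rfl), mTheta_neg_pow hq0 (show 3 + 7 = 10 by rfl),
    mTheta_neg_pow hq0 (show 1 + 9 = 10 by rfl)] at h
  rw [h]
  ring

lemma R_eq {q : ℂ} (hq : ‖q‖ < 1) : R q =
    qp (q ^ 1) (q ^ 10) * qp (q ^ 6) (q ^ 10) * (qp (q ^ 4) (q ^ 10) * qp (q ^ 9) (q ^ 10)) /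
      (qp (q ^ 2) (q ^ 10) * qp (q ^ 7) (q ^ 10) *
        (qp (q ^ 3) (q ^ 10) * qp (q ^ 8) (q ^ 10))) := by
  have h := fun a ↦ qp_pow_pow_split hq a (m := 5) (by norm_num)
  have h1 := h 1
  rw [pow_one] at h1
  rw [R, h1, h 4, h 2, h 3, pow_one]

lemma R_pow (q : ℂ) (n : ℕ) : R (q ^ n) =
    qp (q ^ n) (q ^ (5 * n)) * qp (q ^ (4 * n)) (q ^ (5 * n)) /
      (qp (q ^ (2 * n)) (q ^ (5 * n)) * qp (q ^ (3 * n)) (q ^ (5 * n))) := by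
  simp only [R, ← pow_mul, mul_comm n]

theorem stmt_11 : ∀ q : ℂ, ‖q‖ < 1 →
    R (q ^ 4) / (R q ^ 2 * R (q ^ 2)) - R q ^ 2 * R (q ^ 2) / R (q ^ 4)
      = 4 * q * E (q ^ 4) * E (q ^ 20) ^ 3 / E (q ^ 10) ^ 4 := by
  intro q hq
  rcases eq_or_ne q 0 with rfl | hq0
  · simp [R, qp]
  have key := qp_level_ten_identity hq0 hq
  rw [E_pow_four hq, R_eq hq, R_pow, R_pow]
  norm_num only [Nat.reduceMul]
  have hsplit := fun a ↦ qp_pow_pow_split hq a (m := 10) (by norm_num)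
  have hneg := fun a ↦ qp_pow_mul_qp_neg_pow hq a (m := 10) (by norm_num)
  have h1 := hneg 1
  have h3 := hneg 3
  have h7 := hneg 7
  have h9 := hneg 9
  rw [hsplit 2, hsplit 4, hsplit 6, hsplit 8] at key
  rw [hsplit 2, hsplit 4, hsplit 6, hsplit 8]
  norm_num only [Nat.reduceMul, Nat.reduceAdd] at key h1 h3 h7 h9 ⊢
  have hE := E_ne_zero (norm_pow_lt_one hq (n := 10) (by norm_num))
  have hc2 := qp_pow_ne_zero hq (a := 2) (m := 20) (by norm_num) (by norm_num)
  have hc4 := qp_pow_ne_zero hq (a := 4) (m := 20) (by norm_num) (by norm_num)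
  have hc6 := qp_pow_ne_zero hq (a := 6) (m := 20) (by norm_num) (by norm_num)
  have hc8 := qp_pow_ne_zero hq (a := 8) (m := 20) (by norm_num) (by norm_num)
  have hc12 := qp_pow_ne_zero hq (a := 12) (m := 20) (by norm_num) (by norm_num)
  have hc14 := qp_pow_ne_zero hq (a := 14) (m := 20) (by norm_num) (by norm_num)
  have hc16 := qp_pow_ne_zero hq (a := 16) (m := 20) (by norm_num) (by norm_num)
  have hc18 := qp_pow_ne_zero hq (a := 18) (m := 20) (by norm_num) (by norm_num)
  rw [← h1] at hc2
  rw [← h3] at hc6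
  rw [← h7] at hc14
  rw [← h9] at hc18
  rw [← h1, ← h3, ← h7, ← h9] at key ⊢
  obtain ⟨ha1, hn1⟩ := mul_ne_zero_iff.1 hc2
  obtain ⟨ha3, hn3⟩ := mul_ne_zero_iff.1 hc6
  obtain ⟨ha7, hn7⟩ := mul_ne_zero_iff.1 hc14
  obtain ⟨ha9, hn9⟩ := mul_ne_zero_iff.1 hc18
  rw [pow_one] at ha1 hn1
  field_simp at key ⊢
  linear_combination -key
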